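/- arXiv:math/0101181 — 3 statements merged into one kernel-verified Lean document; each statement's English description precedes it below -/
import Mathlib

section
/- Let L be a sub-bundle of E^1(M) that is isotropic for the symmetric pairing ⟨.,.⟩_+ and such that Γ(L) is closed under the extended Courant bracket [.,.]. Then (L, [.,.], ρ|_L) is a Lie algebroid: the restricted bracket satisfies the Jacobi identity on Γ(L), the anchor ρ|_L (sending (X,f)+(α,g) to X) intertwines the brackets, and [e1, f e2] = f [e1,e2] + (ρ(e1)f) e2 for all e1, e2 ∈ Γ(L) and f ∈ C^∞(M). In particular, every Dirac structure of E^1(M) is a Lie algebroid. -/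
/-!
Algebraic model of the Cartan calculus of a smooth manifold `M`:
`R` models the ring of smooth functions `C^∞(M)`, `V` the vector fields
`Γ(TM)`, and `Ω1, Ω2, Ω3` the modules of differential forms of degree
1, 2, 3.  `lie` is the Lie bracket of vector fields, `d0, d1, d2` the
exterior differentials, `ι1, ι2, ι3` the interior products and
`w11, w12` the wedge products, together with their standard identities
(Leibniz rules, skew-symmetry, the evaluation formulas for `dα`, `dω`,
and nondegeneracy of the interior-product pairings).
Sections of `TM ⊕ T*M` are modeled by `V × Ω1` and sections of
`E^1(M) = (TM × ℝ) ⊕ (T*M × ℝ)` by `(V × R) × (Ω1 × R)`; sub-bundles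
are modeled by their `R`-modules of sections.
-/

namespace ConformalDirac

noncomputable section

structure CartanCalculus (R V Ω1 Ω2 Ω3 : Type*) [CommRing R] [Algebra ℝ R]
    [AddCommGroup V] [Module ℝ V] [Module R V] [IsScalarTower ℝ R V]
    [AddCommGroup Ω1] [Module ℝ Ω1] [Module R Ω1] [IsScalarTower ℝ R Ω1]
    [AddCommGroup Ω2] [Module ℝ Ω2] [Module R Ω2] [IsScalarTower ℝ R Ω2]
    [AddCommGroup Ω3] [Module ℝ Ω3] [Module R Ω3] [IsScalarTower ℝ R Ω3] where
  lie : V →ₗ[ℝ] V →ₗ[ℝ] V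
  d0 : R →ₗ[ℝ] Ω1
  d1 : Ω1 →ₗ[ℝ] Ω2
  d2 : Ω2 →ₗ[ℝ] Ω3
  ι1 : V →ₗ[ℝ] Ω1 →ₗ[ℝ] R
  ι2 : V →ₗ[ℝ] Ω2 →ₗ[ℝ] Ω1
  ι3 : V →ₗ[ℝ] Ω3 →ₗ[ℝ] Ω2
  w11 : Ω1 →ₗ[ℝ] Ω1 →ₗ[ℝ] Ω2
  w12 : Ω1 →ₗ[ℝ] Ω2 →ₗ[ℝ] Ω3
  lie_skew : ∀ X Y, lie X Y = - lie Y X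
  lie_jacobi : ∀ X Y Z, lie (lie X Y) Z + lie (lie Y Z) X + lie (lie Z X) Y = 0
  lie_smul : ∀ (f : R) (X Y : V), lie X (f • Y) = f • lie X Y + (ι1 X (d0 f)) • Y
  ι1_smul_left : ∀ (f : R) X α, ι1 (f • X) α = f * ι1 X α
  ι1_smul_right : ∀ (f : R) X α, ι1 X (f • α) = f * ι1 X α
  ι2_smul_left : ∀ (f : R) X ω, ι2 (f • X) ω = f • ι2 X ω
  ι2_smul_right : ∀ (f : R) X ω, ι2 X (f • ω) = f • ι2 X ω
  ι3_smul_left : ∀ (f : R) X θ, ι3 (f • X) θ = f • ι3 X θ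
  ι3_smul_right : ∀ (f : R) X θ, ι3 X (f • θ) = f • ι3 X θ
  d0_mul : ∀ f g : R, d0 (f * g) = f • d0 g + g • d0 f
  d1_d0 : ∀ f : R, d1 (d0 f) = 0
  d2_d1 : ∀ α, d2 (d1 α) = 0
  d1_smul : ∀ (f : R) α, d1 (f • α) = f • d1 α + w11 (d0 f) α
  d2_smul : ∀ (f : R) ω, d2 (f • ω) = f • d2 ω + w12 (d0 f) ω
  w11_skew : ∀ α β, w11 α β = - w11 β α
  w11_smul_left : ∀ (f : R) α β, w11 (f • α) β = f • w11 α β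
  w12_smul_left : ∀ (f : R) α ω, w12 (f • α) ω = f • w12 α ω
  w12_smul_right : ∀ (f : R) α ω, w12 α (f • ω) = f • w12 α ω
  ι2_w11 : ∀ X α β, ι2 X (w11 α β) = (ι1 X α) • β - (ι1 X β) • α
  ι3_w12 : ∀ X α ω, ι3 X (w12 α ω) = (ι1 X α) • ω - w11 α (ι2 X ω)
  ι2_skew : ∀ X Y ω, ι1 Y (ι2 X ω) = - ι1 X (ι2 Y ω)
  ι3_skew : ∀ X Y θ, ι2 Y (ι3 X θ) = - ι2 X (ι3 Y θ)
  eval_d1 : ∀ X Y α, ι1 Y (ι2 X (d1 α)) =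
      ι1 X (d0 (ι1 Y α)) - ι1 Y (d0 (ι1 X α)) - ι1 (lie X Y) α
  eval_d2 : ∀ X Y Z ω, ι1 Z (ι2 Y (ι3 X (d2 ω))) =
      ι1 X (d0 (ι1 Z (ι2 Y ω))) - ι1 Y (d0 (ι1 Z (ι2 X ω)))
        + ι1 Z (d0 (ι1 Y (ι2 X ω)))
        - ι1 Z (ι2 (lie X Y) ω) + ι1 Y (ι2 (lie X Z) ω) - ι1 X (ι2 (lie Y Z) ω)
  ι1_nondeg_vec : ∀ X, (∀ α, ι1 X α = 0) → X = 0
  ι1_nondeg_form : ∀ α, (∀ X, ι1 X α = 0) → α = 0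
  ι2_nondeg : ∀ ω, (∀ X, ι2 X ω = 0) → ω = 0
  ι3_nondeg : ∀ θ, (∀ X, ι3 X θ = 0) → θ = 0

namespace CartanCalculus

variable {R V Ω1 Ω2 Ω3 : Type*} [CommRing R] [Algebra ℝ R]
    [AddCommGroup V] [Module ℝ V] [Module R V] [IsScalarTower ℝ R V]
    [AddCommGroup Ω1] [Module ℝ Ω1] [Module R Ω1] [IsScalarTower ℝ R Ω1]
    [AddCommGroup Ω2] [Module ℝ Ω2] [Module R Ω2] [IsScalarTower ℝ R Ω2]
    [AddCommGroup Ω3] [Module ℝ Ω3] [Module R Ω3] [IsScalarTower ℝ R Ω3]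
    (C : CartanCalculus R V Ω1 Ω2 Ω3)

/-- `X ⬝ f = i_X (df)`, the action of a vector field on a function. -/
def Xdot (X : V) (f : R) : R := C.ι1 X (C.d0 f)

/-- Lie derivative of a 1-form, via Cartan's magic formula
`L_X α = d (i_X α) + i_X (dα)`. -/
def lieD (X : V) (α : Ω1) : Ω1 := C.d0 (C.ι1 X α) + C.ι2 X (C.d1 α)

/-- The Courant bracket on sections of `TM ⊕ T*M`:
`[X1+α1, X2+α2]_c = [X1,X2] + L_{X1}α2 − L_{X2}α1 + (1/2) d(i_{X2}α1 − i_{X1}α2)`. -/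
def courant (e1 e2 : V × Ω1) : V × Ω1 :=
  (C.lie e1.1 e2.1,
    C.lieD e1.1 e2.2 - C.lieD e2.1 e1.2
      + (2⁻¹ : ℝ) • C.d0 (C.ι1 e2.1 e1.2 - C.ι1 e1.1 e2.2))

/-- The canonical symmetric pairing on `TM ⊕ T*M`:
`⟨X1+α1, X2+α2⟩_+ = (1/2)(i_{X2}α1 + i_{X1}α2)`. -/
def pairPlus (e1 e2 : V × Ω1) : R :=
  (2⁻¹ : ℝ) • (C.ι1 e2.1 e1.2 + C.ι1 e1.1 e2.2)

/-- A sub-bundle of `TM ⊕ T*M` (given by its module of sections) is isotropic. -/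
def IsIsotropicT (L : Submodule R (V × Ω1)) : Prop :=
  ∀ e1 ∈ L, ∀ e2 ∈ L, C.pairPlus e1 e2 = 0

/-- Maximally isotropic sub-bundle of `TM ⊕ T*M`. -/
def IsMaxIsotropicT (L : Submodule R (V × Ω1)) : Prop :=
  C.IsIsotropicT L ∧ ∀ e, (∀ e' ∈ L, C.pairPlus e e' = 0) → e ∈ L

/-- A Dirac structure on `M`: a maximally isotropic sub-bundle of `TM ⊕ T*M`
whose sections are closed under the Courant bracket. -/
def IsDiracT (L : Submodule R (V × Ω1)) : Prop :=
  C.IsMaxIsotropicT L ∧ ∀ e1 ∈ L, ∀ e2 ∈ L, C.courant e1 e2 ∈ L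

/-! Sections of `E^1(M) = (TM × ℝ) ⊕ (T*M × ℝ)` are modeled by
`(V × R) × (Ω1 × R)`; an element `((X,f),(α,g))` is the section
`(X,f)+(α,g)` of the paper. -/

/-- The canonical symmetric pairing on `E^1(M)`:
`⟨(X1,μ1)+(α1,λ1), (X2,μ2)+(α2,λ2)⟩_+
  = (1/2)(i_{X2}α1 + i_{X1}α2 + λ1 μ2 + λ2 μ1)`. -/
def pairPlusE (e1 e2 : (V × R) × (Ω1 × R)) : R :=
  (2⁻¹ : ℝ) • (C.ι1 e2.1.1 e1.2.1 + C.ι1 e1.1.1 e2.2.1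
      + e1.2.2 * e2.1.2 + e2.2.2 * e1.1.2)

/-- The skew-symmetric pairing on `E^1(M)`:
`⟨(X1,μ1)+(α1,λ1), (X2,μ2)+(α2,λ2)⟩_−
  = (1/2)(i_{X2}α1 − i_{X1}α2 + λ1 μ2 − λ2 μ1)`. -/
def pairMinusE (e1 e2 : (V × R) × (Ω1 × R)) : R :=
  (2⁻¹ : ℝ) • (C.ι1 e2.1.1 e1.2.1 - C.ι1 e1.1.1 e2.2.1
      + e1.2.2 * e2.1.2 - e2.2.2 * e1.1.2)

/-- The extended Courant bracket on sections of `E^1(M)`. -/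
def ebracket (e1 e2 : (V × R) × (Ω1 × R)) : (V × R) × (Ω1 × R) :=
  ((C.lie e1.1.1 e2.1.1, C.Xdot e1.1.1 e2.1.2 - C.Xdot e2.1.1 e1.1.2),
   (C.lieD e1.1.1 e2.2.1 - C.lieD e2.1.1 e1.2.1
      + (2⁻¹ : ℝ) • C.d0 (C.ι1 e2.1.1 e1.2.1 - C.ι1 e1.1.1 e2.2.1)
      + e1.1.2 • e2.2.1 - e2.1.2 • e1.2.1
      + (2⁻¹ : ℝ) • (e2.2.2 • C.d0 e1.1.2 - e1.2.2 • C.d0 e2.1.2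
          - e1.1.2 • C.d0 e2.2.2 + e2.1.2 • C.d0 e1.2.2),
    C.Xdot e1.1.1 e2.2.2 - C.Xdot e2.1.1 e1.2.2
      + (2⁻¹ : ℝ) • (C.ι1 e2.1.1 e1.2.1 - C.ι1 e1.1.1 e2.2.1
          - e2.1.2 * e1.2.2 + e1.1.2 * e2.2.2)))

/-- Isotropic sub-bundle of `E^1(M)`. -/
def IsIsotropicE (L : Submodule R ((V × R) × (Ω1 × R))) : Prop :=
  ∀ e1 ∈ L, ∀ e2 ∈ L, C.pairPlusE e1 e2 = 0

/-- Maximally isotropic sub-bundle of `E^1(M)`. -/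
def IsMaxIsotropicE (L : Submodule R ((V × R) × (Ω1 × R))) : Prop :=
  C.IsIsotropicE L ∧ ∀ e, (∀ e' ∈ L, C.pairPlusE e e' = 0) → e ∈ L

/-- A Dirac structure of `E^1(M)`: a maximally isotropic sub-bundle whose
sections are closed under the extended Courant bracket. -/
def IsDiracE (L : Submodule R ((V × R) × (Ω1 × R))) : Prop :=
  C.IsMaxIsotropicE L ∧ ∀ e1 ∈ L, ∀ e2 ∈ L, C.ebracket e1 e2 ∈ L

/-- `f` is `L`-admissible: there are `X_f`, `φ_f` with
`(X_f, φ_f) + (df, f) ∈ Γ(L)`. -/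
def IsAdmissible (L : Submodule R ((V × R) × (Ω1 × R))) (f : R) : Prop :=
  ∃ (Xf : V) (φf : R), ((Xf, φf), (C.d0 f, f)) ∈ L

/-- `e` is a section of `L` of the form `e_f = (X_f, φ_f) + (df, f)`
witnessing admissibility of `f`. -/
def AdmSec (L : Submodule R ((V × R) × (Ω1 × R))) (f : R)
    (e : (V × R) × (Ω1 × R)) : Prop :=
  e ∈ L ∧ e.2.1 = C.d0 f ∧ e.2.2 = f

/-- The Koszul bracket of 1-forms associated to a bivector `π`:
`[α,β]_π = L_{πα}β − L_{πβ}α − d(π(α,β))`. -/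
def koszul (π : Ω1 →ₗ[R] V) (α β : Ω1) : Ω1 :=
  C.lieD (π α) β - C.lieD (π β) α - C.d0 (C.ι1 (π α) β)

/-- `π` is a skew-symmetric bivector: `i_{πα}β = −i_{πβ}α`, i.e.
`π(α,β) = −π(β,α)`. -/
def IsSkewBivector (π : Ω1 →ₗ[R] V) : Prop :=
  ∀ α β, C.ι1 (π α) β = - C.ι1 (π β) α

/-- `[π,π]_s = 0` (the Schouten–Nijenhuis square of `π` vanishes), expressed
through the standard equivalent identity `π [α,β]_π = [πα, πβ]`. -/
def IsPoissonBivector (π : Ω1 →ₗ[R] V) : Prop :=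
  ∀ α β, π (C.koszul π α β) = C.lie (π α) (π β)

/-- `(π, E)` is a Jacobi structure: `[E,π]_s = 0` and `[π,π]_s = 2 E ∧ π`.
The first condition is expressed through `[E,π]_s α = [E,πα] − π(L_E α)`;
the second through the evaluation of `(1/2)[π,π]_s(α,β,γ)
 = ⟨[πα,πβ] − π[α,β]_π, γ⟩` against `(E ∧ π)(α,β,γ)`. -/
def IsJacobiPair (π : Ω1 →ₗ[R] V) (E : V) : Prop :=
  (∀ α, C.lie E (π α) - π (C.lieD E α) = 0) ∧
  (∀ α β γ, C.ι1 (C.lie (π α) (π β) - π (C.koszul π α β)) γ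
      = C.ι1 E α * C.ι1 (π β) γ - C.ι1 E β * C.ι1 (π α) γ
        + C.ι1 E γ * C.ι1 (π α) β)

/-- The graph of the bundle map `P(α,g) = (πα + gE, −i_E α)` associated to a
pair `(π, E)`, as a sub-bundle of `E^1(M)`. -/
def jacobiGraph (π : Ω1 →ₗ[R] V) (E : V) :
    Submodule R ((V × R) × (Ω1 × R)) :=
  Submodule.span R
    {e : (V × R) × (Ω1 × R) |
      e.1.1 = π e.2.1 + e.2.2 • E ∧ e.1.2 = -(C.ι1 E e.2.1)}

/-- The twist `(X,φ)+(α,f) ↦ (aX + fY, aφ − i_Y α) + (α,f)`. -/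
def twistFun (a : R) (Y : V) (e : (V × R) × (Ω1 × R)) :
    (V × R) × (Ω1 × R) :=
  ((a • e.1.1 + e.2.2 • Y, a * e.1.2 - C.ι1 Y e.2.1), e.2)

/-- The sub-bundle of `E^1(M)` spanned by the `(a,Y)`-twists of the sections
of `L`. -/
def conf (L : Submodule R ((V × R) × (Ω1 × R))) (a : R) (Y : V) :
    Submodule R ((V × R) × (Ω1 × R)) :=
  Submodule.span R (C.twistFun a Y '' (L : Set ((V × R) × (Ω1 × R))))

end CartanCalculus
end
end ConformalDirac

namespace ConformalDirac

variable {R V Ω1 Ω2 Ω3 : Type*} [CommRing R] [Algebra ℝ R]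
    [AddCommGroup V] [Module ℝ V] [Module R V] [IsScalarTower ℝ R V]
    [AddCommGroup Ω1] [Module ℝ Ω1] [Module R Ω1] [IsScalarTower ℝ R Ω1]
    [AddCommGroup Ω2] [Module ℝ Ω2] [Module R Ω2] [IsScalarTower ℝ R Ω2]
    [AddCommGroup Ω3] [Module ℝ Ω3] [Module R Ω3] [IsScalarTower ℝ R Ω3]
    (C : CartanCalculus R V Ω1 Ω2 Ω3)


namespace CartanCalculus

/-- Two 1-forms agree if all their contractions with vector fields do. -/
theorem form_ext {α β : Ω1} (h : ∀ Y, C.ι1 Y α = C.ι1 Y β) : α = β :=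
  sub_eq_zero.mp <| C.ι1_nondeg_form _ fun Y => by rw [map_sub, h, sub_self]

theorem Xdot_lie (X Y : V) (h : R) :
    C.Xdot (C.lie X Y) h = C.Xdot X (C.Xdot Y h) - C.Xdot Y (C.Xdot X h) := by
  have H := C.eval_d1 X Y (C.d0 h)
  rw [C.d1_d0, map_zero, map_zero] at H
  simp only [Xdot]
  linear_combination H

theorem Xdot_add (X : V) (f g : R) : C.Xdot X (f + g) = C.Xdot X f + C.Xdot X g := by
  simp only [Xdot, map_add]

theorem Xdot_sub (X : V) (f g : R) : C.Xdot X (f - g) = C.Xdot X f - C.Xdot X g := by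
  simp only [Xdot, map_sub]

theorem Xdot_mul (X : V) (f g : R) :
    C.Xdot X (f * g) = f * C.Xdot X g + g * C.Xdot X f := by
  simp only [Xdot, C.d0_mul, map_add, C.ι1_smul_right]

theorem ι1_d0 (X : V) (f : R) : C.ι1 X (C.d0 f) = C.Xdot X f := rfl

theorem ι1_ι2_d1 (X Y : V) (α : Ω1) : C.ι1 Y (C.ι2 X (C.d1 α)) =
    C.Xdot X (C.ι1 Y α) - C.Xdot Y (C.ι1 X α) - C.ι1 (C.lie X Y) α :=
  C.eval_d1 X Y α

/-- The non-skew (Dorfman) version of the extended Courant bracket. -/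
noncomputable def dorfman (e1 e2 : (V × R) × (Ω1 × R)) : (V × R) × (Ω1 × R) :=
  ((C.lie e1.1.1 e2.1.1, C.Xdot e1.1.1 e2.1.2 - C.Xdot e2.1.1 e1.1.2),
   (C.lieD e1.1.1 e2.2.1 - C.ι2 e2.1.1 (C.d1 e1.2.1)
      + e1.1.2 • e2.2.1 - e2.1.2 • e1.2.1
      + e2.2.2 • C.d0 e1.1.2 + e2.1.2 • C.d0 e1.2.2,
    C.Xdot e1.1.1 e2.2.2 - C.Xdot e2.1.1 e1.2.2
      + C.ι1 e2.1.1 e1.2.1 + e1.1.2 * e2.2.2))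

theorem ι1_dorfman (e1 e2 : (V × R) × (Ω1 × R)) (Y : V) :
    C.ι1 Y (C.dorfman e1 e2).2.1 =
      C.Xdot e1.1.1 (C.ι1 Y e2.2.1) - C.ι1 (C.lie e1.1.1 Y) e2.2.1
      - (C.Xdot e2.1.1 (C.ι1 Y e1.2.1) - C.Xdot Y (C.ι1 e2.1.1 e1.2.1)
          - C.ι1 (C.lie e2.1.1 Y) e1.2.1)
      + e1.1.2 * C.ι1 Y e2.2.1 - e2.1.2 * C.ι1 Y e1.2.1
      + e2.2.2 * C.Xdot Y e1.1.2 + e2.1.2 * C.Xdot Y e1.2.2 := by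
  simp only [dorfman, lieD, map_add, map_sub, C.ι1_smul_right, ι1_d0, ι1_ι2_d1]
  ring

theorem lie_lie (X Y Z : V) :
    C.lie (C.lie X Y) Z = C.lie X (C.lie Y Z) - C.lie Y (C.lie X Z) := by
  have h := C.lie_jacobi X Y Z
  rw [C.lie_skew (C.lie Y Z) X, C.lie_skew (C.lie Z X) Y, C.lie_skew Z X, map_neg] at h
  rw [← sub_eq_zero, ← h]
  abel

/-- The Dorfman bracket satisfies the Leibniz form of the Jacobi identity on all sections. -/
theorem dorfman_dorfman (e1 e2 e3 : (V × R) × (Ω1 × R)) :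
    C.dorfman (C.dorfman e1 e2) e3 =
      C.dorfman e1 (C.dorfman e2 e3) - C.dorfman e2 (C.dorfman e1 e3) := by
  refine Prod.ext (Prod.ext (C.lie_lie _ _ _) ?_) (Prod.ext ?_ ?_)
  · simp only [dorfman, Prod.fst_sub, Prod.snd_sub, Xdot_lie, Xdot_sub]
    ring
  · refine C.form_ext fun Y => ?_
    rw [Prod.snd_sub, Prod.fst_sub, map_sub]
    simp only [ι1_dorfman]
    simp only [dorfman, Xdot_lie, Xdot_sub, Xdot_add, Xdot_mul, lie_lie, map_sub,
      LinearMap.sub_apply]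
    ring
  · rw [Prod.snd_sub, Prod.snd_sub]
    change C.Xdot (C.lie _ _) _ - C.Xdot _ (C.Xdot _ _ - C.Xdot _ _ + _ + _)
      + C.ι1 _ (C.dorfman e1 e2).2.1 + _ = _
    simp only [ι1_dorfman]
    simp only [dorfman, Xdot_lie, Xdot_sub, Xdot_add, Xdot_mul]
    ring

/-- The symmetric pairing vanishes only if it does so without its factor `1/2`. -/
theorem pairing_eq_zero {e1 e2 : (V × R) × (Ω1 × R)} (h : C.pairPlusE e1 e2 = 0) :
    C.ι1 e2.1.1 e1.2.1 + C.ι1 e1.1.1 e2.2.1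
      + e1.2.2 * e2.1.2 + e2.2.2 * e1.1.2 = 0 :=
  (smul_eq_zero_iff_right (by norm_num : (2⁻¹ : ℝ) ≠ 0)).mp h

/-- On orthogonal sections the extended Courant bracket is the Dorfman bracket. -/
theorem ebracket_eq_dorfman {e1 e2 : (V × R) × (Ω1 × R)} (h : C.pairPlusE e1 e2 = 0) :
    C.ebracket e1 e2 = C.dorfman e1 e2 := by
  have h0 := C.pairing_eq_zero h
  have hc : (2 : R) * algebraMap ℝ R 2⁻¹ = 1 := by
    rw [← map_ofNat (algebraMap ℝ R) 2, ← map_mul]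
    norm_num
  refine Prod.ext (Prod.ext rfl rfl) (Prod.ext ?_ ?_)
  · refine C.form_ext fun Y => ?_
    have hY := congrArg (C.Xdot Y) h0
    have hz : C.Xdot Y 0 = 0 := by simp only [Xdot, map_zero]
    simp only [Xdot_add, Xdot_mul, hz] at hY
    rw [ι1_dorfman]
    simp only [ebracket, lieD, map_add, map_sub, map_smul, C.ι1_smul_right, ι1_d0, ι1_ι2_d1,
      Algebra.smul_def]
    linear_combination -(algebraMap ℝ R 2⁻¹) * hY + (C.Xdot Y (C.ι1 e2.1.1 e1.2.1)
      + e2.1.2 * C.Xdot Y e1.2.2 + e2.2.2 * C.Xdot Y e1.1.2) * hc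
  · simp only [ebracket, dorfman, Algebra.smul_def]
    linear_combination -(algebraMap ℝ R 2⁻¹) * h0
      + (C.ι1 e2.1.1 e1.2.1 + e1.1.2 * e2.2.2) * hc

theorem ebracket_skew (e1 e2 : (V × R) × (Ω1 × R)) :
    C.ebracket e1 e2 = - C.ebracket e2 e1 := by
  refine Prod.ext (Prod.ext (C.lie_skew _ _) ?_) (Prod.ext ?_ ?_)
  · simp only [ebracket, Prod.fst_neg, Prod.snd_neg]
    ring
  · simp only [ebracket, Prod.fst_neg, Prod.snd_neg, map_sub]
    module
  · simp only [ebracket, Prod.snd_neg, Algebra.smul_def]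
    ring

theorem ebracket_neg_right (e1 e2 : (V × R) × (Ω1 × R)) :
    C.ebracket e1 (-e2) = - C.ebracket e1 e2 := by
  refine Prod.ext (Prod.ext (map_neg _ _) ?_) (Prod.ext ?_ ?_)
  · simp only [ebracket, Xdot, Prod.fst_neg, Prod.snd_neg, map_neg, LinearMap.neg_apply]
    ring
  · simp only [ebracket, lieD, Prod.fst_neg, Prod.snd_neg, map_neg, map_sub, LinearMap.neg_apply]
    module
  · simp only [ebracket, Xdot, Prod.fst_neg, Prod.snd_neg, map_neg, LinearMap.neg_apply,
      Algebra.smul_def]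
    ring

theorem dorfman_smul (f : R) (e1 e2 : (V × R) × (Ω1 × R)) :
    C.dorfman e1 (f • e2) = f • C.dorfman e1 e2 + C.Xdot e1.1.1 f • e2 := by
  have hX : ∀ X h, C.Xdot (f • X) h = f * C.Xdot X h := fun X h => C.ι1_smul_left _ _ _
  refine Prod.ext (Prod.ext (C.lie_smul _ _ _) ?_) (Prod.ext ?_ ?_)
  · simp only [dorfman, Prod.fst_add, Prod.snd_add, Prod.smul_fst, Prod.smul_snd, smul_eq_mul,
      Xdot_mul, hX]
    ring
  · refine C.form_ext fun Y => ?_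
    simp only [dorfman, lieD, Prod.fst_add, Prod.snd_add, Prod.smul_fst, Prod.smul_snd,
      smul_eq_mul, map_add, map_sub, C.ι1_smul_right, C.ι1_smul_left, C.ι2_smul_left,
      C.ι2_smul_right, C.d1_smul, C.ι2_w11, ι1_d0, Xdot_mul, hX]
    ring
  · simp only [dorfman, Prod.snd_add, Prod.smul_fst, Prod.smul_snd, smul_eq_mul, Xdot_mul, hX,
      C.ι1_smul_left]
    ring

end CartanCalculus

/-- Theorem 3.1: any isotropic sub-bundle `L` of
`(E^1(M), ⟨.,.⟩_+)` whose sections are closed under the extended Courant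
bracket is a Lie algebroid with anchor `ρ((X,f)+(α,g)) = X`: the bracket
satisfies the Jacobi identity on `Γ(L)`, the anchor intertwines the brackets,
and the Leibniz rule holds.  In particular any Dirac structure of `E^1(M)`
is a Lie algebroid. -/
theorem dirac_is_lie_algebroid (L : Submodule R ((V × R) × (Ω1 × R)))
    (hiso : C.IsIsotropicE L)
    (hclosed : ∀ e1 ∈ L, ∀ e2 ∈ L, C.ebracket e1 e2 ∈ L) :
    (∀ e1 ∈ L, ∀ e2 ∈ L, ∀ e3 ∈ L,
        C.ebracket (C.ebracket e1 e2) e3 + C.ebracket (C.ebracket e2 e3) e1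
          + C.ebracket (C.ebracket e3 e1) e2 = 0)
    ∧ (∀ e1 ∈ L, ∀ e2 ∈ L,
        (C.ebracket e1 e2).1.1 = C.lie e1.1.1 e2.1.1
          ∧ ∀ h : R, C.Xdot (C.ebracket e1 e2).1.1 h
              = C.Xdot e1.1.1 (C.Xdot e2.1.1 h) - C.Xdot e2.1.1 (C.Xdot e1.1.1 h))
    ∧ (∀ e1 ∈ L, ∀ e2 ∈ L, ∀ f : R,
        C.ebracket e1 (f • e2) = f • C.ebracket e1 e2 + (C.Xdot e1.1.1 f) • e2) := by
  have hD : ∀ e1 ∈ L, ∀ e2 ∈ L, C.ebracket e1 e2 = C.dorfman e1 e2 :=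
    fun e1 h1 e2 h2 => C.ebracket_eq_dorfman (hiso e1 h1 e2 h2)
  refine ⟨fun e1 h1 e2 h2 e3 h3 => ?_, fun e1 _ e2 _ => ⟨rfl, C.Xdot_lie _ _⟩,
    fun e1 h1 e2 h2 f => ?_⟩
  · have key : C.ebracket (C.ebracket e1 e2) e3 =
        C.ebracket e1 (C.ebracket e2 e3) - C.ebracket e2 (C.ebracket e1 e3) := by
      rw [hD _ (hclosed _ h1 _ h2) _ h3, hD _ h1 _ (hclosed _ h2 _ h3),
        hD _ h2 _ (hclosed _ h1 _ h3), hD _ h1 _ h2, hD _ h2 _ h3, hD _ h1 _ h3,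
        C.dorfman_dorfman]
    rw [key, C.ebracket_skew (C.ebracket e2 e3) e1, C.ebracket_skew (C.ebracket e3 e1) e2,
      C.ebracket_skew e3 e1, C.ebracket_neg_right]
    abel
  · rw [hD _ h1 _ (L.smul_mem f h2), hD _ h1 _ h2, C.dorfman_smul]

end ConformalDirac
end

section
/- Let π be a bivector field and Z a vector field on M, and let L_{(π,Z)} ⊂ E^1(M) be the sub-bundle whose fibre at x is { (πα − fZ, f)_x + (α, i_Z α)_x | α a smooth 1-form, f ∈ C^∞(M) }, where πα is the vector field with i_{πα}β = π(α,β). Then L_{(π,Z)} is a Dirac structure of E^1(M) if and only if (M, π, Z) is a homogeneous Poisson manifold, i.e. [π,π]_s = 0 and [Z,π]_s = −π, where [.,.]_s is the Schouten–Nijenhuis bracket. -/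
namespace ConformalDirac

variable {R V Ω1 Ω2 Ω3 : Type*} [CommRing R] [Algebra ℝ R]
    [AddCommGroup V] [Module ℝ V] [Module R V] [IsScalarTower ℝ R V]
    [AddCommGroup Ω1] [Module ℝ Ω1] [Module R Ω1] [IsScalarTower ℝ R Ω1]
    [AddCommGroup Ω2] [Module ℝ Ω2] [Module R Ω2] [IsScalarTower ℝ R Ω2]
    [AddCommGroup Ω3] [Module ℝ Ω3] [Module R Ω3] [IsScalarTower ℝ R Ω3]
    (C : CartanCalculus R V Ω1 Ω2 Ω3)


namespace CartanCalculus

theorem algebraMap_inv_two_add_self (R : Type*) [CommRing R] [Algebra ℝ R] :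
    algebraMap ℝ R 2⁻¹ + algebraMap ℝ R 2⁻¹ = 1 := by
  rw [← map_add]
  norm_num

theorem lie_self (X : V) : C.lie X X = 0 := by
  have h := C.lie_skew X X
  linear_combination (norm := module) (2⁻¹ : ℝ) • h

theorem smul_lie (f : R) (X Y : V) :
    C.lie (f • X) Y = f • C.lie X Y - C.ι1 Y (C.d0 f) • X := by
  rw [C.lie_skew, C.lie_smul, C.lie_skew Y X]
  module

theorem lieD_sub_left (X Y : V) (α : Ω1) :
    C.lieD (X - Y) α = C.lieD X α - C.lieD Y α := by
  simp only [lieD, map_sub, LinearMap.sub_apply]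
  abel

theorem lieD_smul_left (f : R) (X : V) (α : Ω1) :
    C.lieD (f • X) α = f • C.lieD X α + C.ι1 X α • C.d0 f := by
  simp only [lieD, C.ι1_smul_left, C.ι2_smul_left, C.d0_mul]
  module

theorem ι1_lieD (X Y : V) (α : Ω1) :
    C.ι1 Y (C.lieD X α) = C.ι1 X (C.d0 (C.ι1 Y α)) - C.ι1 (C.lie X Y) α := by
  rw [lieD, map_add, C.eval_d1]
  ring

/-- The sections of `L_{(π,Z)}`. -/
def homogeneousGraph (π : Ω1 →ₗ[R] V) (Z : V) : Submodule R ((V × R) × (Ω1 × R)) where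
  carrier := {e | e.1.1 = π e.2.1 - e.1.2 • Z ∧ e.2.2 = C.ι1 Z e.2.1}
  add_mem' := by
    rintro e e' ⟨h₁, h₂⟩ ⟨h₁', h₂'⟩
    refine ⟨?_, ?_⟩
    · simp only [Prod.fst_add, Prod.snd_add, h₁, h₁', map_add]
      module
    · simp only [Prod.fst_add, Prod.snd_add, h₂, h₂', map_add]
  zero_mem' := by simp
  smul_mem' := by
    rintro c e ⟨h₁, h₂⟩
    refine ⟨?_, ?_⟩
    · simp only [Prod.smul_fst, Prod.smul_snd, h₁, map_smul, smul_eq_mul]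
      module
    · simp only [Prod.smul_fst, Prod.smul_snd, h₂, C.ι1_smul_right, smul_eq_mul]

theorem mem_homogeneousGraph {π : Ω1 →ₗ[R] V} {Z : V} {e : (V × R) × (Ω1 × R)} :
    e ∈ C.homogeneousGraph π Z ↔ e.1.1 = π e.2.1 - e.1.2 • Z ∧ e.2.2 = C.ι1 Z e.2.1 :=
  Iff.rfl

theorem isMaxIsotropicE_homogeneousGraph {π : Ω1 →ₗ[R] V} (hπ : C.IsSkewBivector π) (Z : V) :
    C.IsMaxIsotropicE (C.homogeneousGraph π Z) := by
  constructor
  · rintro ⟨⟨X, f⟩, α, a⟩ ⟨h₁, h₂⟩ ⟨⟨Y, g⟩, β, b⟩ ⟨h₁', h₂'⟩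
    simp only at h₁ h₂ h₁' h₂'
    subst h₁ h₂ h₁' h₂'
    have h := hπ α β
    simp only [pairPlusE, map_sub, LinearMap.sub_apply, C.ι1_smul_left]
    convert smul_zero (2⁻¹ : ℝ) using 2
    linear_combination h
  · rintro ⟨⟨X, f⟩, β, b⟩ h
    have key : ∀ e' ∈ C.homogeneousGraph π Z, C.ι1 e'.1.1 β + C.ι1 X e'.2.1
        + b * e'.1.2 + e'.2.2 * f = 0 := fun e' he' => by
      have h' := h e' he'
      rw [pairPlusE] at h'
      exact (smul_eq_zero_iff_right (by norm_num)).mp h'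
    refine ⟨sub_eq_zero.mp (C.ι1_nondeg_vec _ fun α => ?_), ?_⟩
    · have h' := key ((π α, 0), (α, C.ι1 Z α)) (by simp [mem_homogeneousGraph])
      have hs := hπ α β
      simp only [map_sub, LinearMap.sub_apply, C.ι1_smul_left] at h' ⊢
      linear_combination h' - hs
    · have h' := key ((-Z, 1), (0, 0)) (by simp [mem_homogeneousGraph])
      simp only [map_neg, map_zero, LinearMap.neg_apply] at h' ⊢
      linear_combination h'

/-- The 1-form part of the bracket of two sections of `L_{(π,Z)}`. -/
theorem ebracket_homogeneousGraph_form {π : Ω1 →ₗ[R] V} (hπ : C.IsSkewBivector π) (Z : V)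
    (α β : Ω1) (f g : R) :
    (C.ebracket ((π α - f • Z, f), (α, C.ι1 Z α)) ((π β - g • Z, g), (β, C.ι1 Z β))).2.1
      = C.koszul π α β + f • (β - C.lieD Z β) - g • (α - C.lieD Z α) := by
  have h2 : ∀ x : Ω1, (2⁻¹ : ℝ) • x = algebraMap ℝ R 2⁻¹ • x := fun x =>
    (algebraMap_smul R _ x).symm
  have hh := algebraMap_inv_two_add_self R
  simp only [ebracket, koszul, lieD_sub_left, lieD_smul_left, map_sub, LinearMap.sub_apply,
    C.ι1_smul_left, C.d0_mul, hπ β α, map_neg, h2]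
  linear_combination (norm := module)
    hh • (C.ι1 Z β • C.d0 f - C.ι1 Z α • C.d0 g - C.d0 (C.ι1 (π α) β))

/-- The vector field part of the bracket of two sections of `L_{(π,Z)}`. -/
theorem ebracket_homogeneousGraph_vec (π : Ω1 →ₗ[R] V) (Z : V) (α β : Ω1) (f g a b : R) :
    (C.ebracket ((π α - f • Z, f), (α, a)) ((π β - g • Z, g), (β, b))).1.1
      = C.lie (π α) (π β) - f • C.lie Z (π β) + g • C.lie Z (π α)
        - (C.ebracket ((π α - f • Z, f), (α, a)) ((π β - g • Z, g), (β, b))).1.2 • Z := by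
  simp only [ebracket, Xdot, map_sub, LinearMap.sub_apply, C.lie_smul, C.smul_lie,
    C.ι1_smul_left, C.lie_self, C.lie_skew (π α) Z]
  module

theorem isPoissonBivector_of_isDiracE {π : Ω1 →ₗ[R] V} (hπ : C.IsSkewBivector π) {Z : V}
    (h : C.IsDiracE (C.homogeneousGraph π Z)) : C.IsPoissonBivector π := by
  intro α β
  have hb := (h.2 ((π α - (0 : R) • Z, 0), (α, C.ι1 Z α)) ⟨rfl, rfl⟩
    ((π β - (0 : R) • Z, 0), (β, C.ι1 Z β)) ⟨rfl, rfl⟩).1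
  rw [ebracket_homogeneousGraph_vec, C.ebracket_homogeneousGraph_form hπ] at hb
  simpa using (sub_left_injective hb).symm

theorem lie_homogeneous_of_isDiracE {π : Ω1 →ₗ[R] V} (hπ : C.IsSkewBivector π) {Z : V}
    (h : C.IsDiracE (C.homogeneousGraph π Z)) (α : Ω1) :
    C.lie Z (π α) - π (C.lieD Z α) = -(π α) := by
  have hb := (h.2 ((π 0 - (1 : R) • Z, 1), (0, C.ι1 Z 0)) ⟨rfl, rfl⟩
    ((π α - (0 : R) • Z, 0), (α, C.ι1 Z α)) ⟨rfl, rfl⟩).1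
  rw [ebracket_homogeneousGraph_vec, C.ebracket_homogeneousGraph_form hπ] at hb
  have hb' := sub_left_injective hb
  simp only [koszul, lieD, map_zero, LinearMap.zero_apply, map_add, map_sub, one_smul, zero_smul,
    hπ α 0, add_zero, sub_zero, zero_sub] at hb' ⊢
  simp only [neg_zero, map_zero, zero_add] at hb'
  linear_combination (norm := module) -hb'

theorem ebracket_mem_homogeneousGraph {π : Ω1 →ₗ[R] V} (hπ : C.IsSkewBivector π) {Z : V}
    (hP : C.IsPoissonBivector π) (hZ : ∀ α, C.lie Z (π α) - π (C.lieD Z α) = -(π α)) :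
    ∀ e₁ ∈ C.homogeneousGraph π Z, ∀ e₂ ∈ C.homogeneousGraph π Z,
      C.ebracket e₁ e₂ ∈ C.homogeneousGraph π Z := by
  rintro ⟨⟨X, f⟩, α, a⟩ ⟨h₁, h₂⟩ ⟨⟨Y, g⟩, β, b⟩ ⟨h₁', h₂'⟩
  simp only at h₁ h₂ h₁' h₂'
  subst h₁ h₂ h₁' h₂'
  rw [mem_homogeneousGraph, ebracket_homogeneousGraph_vec, C.ebracket_homogeneousGraph_form hπ]
  refine ⟨?_, ?_⟩
  · simp only [map_add, map_sub, map_smul, hP α β]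
    linear_combination (norm := module) g • hZ α - f • hZ β
  · have hh := algebraMap_inv_two_add_self R
    have hβ : C.ι1 (C.lie Z (π β)) α - C.ι1 (π (C.lieD Z β)) α = - C.ι1 (π β) α := by
      rw [← LinearMap.sub_apply, ← map_sub, hZ, map_neg, LinearMap.neg_apply]
    have hL : C.ι1 (π α) (C.lieD Z β) = -C.ι1 (π (C.lieD Z β)) α := hπ _ _
    have hs := hπ β α
    simp only [C.ι1_lieD] at hL
    simp only [ebracket, koszul, Xdot, map_add, map_sub, LinearMap.sub_apply, ι1_lieD,
      C.ι1_smul_left, C.ι1_smul_right, C.lie_skew (π α) Z, C.lie_skew (π β) Z,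
      C.lie_self, map_neg, LinearMap.neg_apply, map_zero, LinearMap.zero_apply, Algebra.smul_def, hs] at hβ hL ⊢
    linear_combination hL + hβ +
      hh * (f * C.ι1 Z β - g * C.ι1 Z α - C.ι1 (π α) β)

end CartanCalculus

/-- Proposition 4.2: the sub-bundle `L_{(π,Z)}` with fibre
`{(πα − fZ, f) + (α, i_Z α)}` is a Dirac structure of `E^1(M)` if and only if
`(M,π,Z)` is a homogeneous Poisson manifold: `[π,π]_s = 0` and
`[Z,π]_s = −π` (the latter via `[Z,π]_s α = [Z,πα] − π(L_Z α)`). -/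
theorem homogeneous_poisson_dirac (π : Ω1 →ₗ[R] V)
    (hπ : C.IsSkewBivector π) (Z : V) :
    C.IsDiracE (Submodule.span R
        {e : (V × R) × (Ω1 × R) |
          e.1.1 = π e.2.1 - e.1.2 • Z ∧ e.2.2 = C.ι1 Z e.2.1})
      ↔ (C.IsPoissonBivector π
          ∧ ∀ α, C.lie Z (π α) - π (C.lieD Z α) = -(π α)) := by
  change C.IsDiracE (Submodule.span R (C.homogeneousGraph π Z : Set ((V × R) × (Ω1 × R)))) ↔ _
  rw [Submodule.span_eq]
  exact ⟨fun h => ⟨C.isPoissonBivector_of_isDiracE hπ h, C.lie_homogeneous_of_isDiracE hπ h⟩,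
    fun h => ⟨C.isMaxIsotropicE_homogeneousGraph hπ Z,
      C.ebracket_mem_homogeneousGraph hπ h.1 h.2⟩⟩

end ConformalDirac
end

section
/- Let ω be a 2-form and α a 1-form on M, and let φ_B: TM × ℝ → T*M × ℝ be the bundle map given on sections by φ_B(X,f) = (i_X ω + f α, −i_X α). Then the graph of φ_B is a Dirac structure of E^1(M) if and only if ω = dα. -/
namespace ConformalDirac

variable {R V Ω1 Ω2 Ω3 : Type*} [CommRing R] [Algebra ℝ R]
    [AddCommGroup V] [Module ℝ V] [Module R V] [IsScalarTower ℝ R V]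
    [AddCommGroup Ω1] [Module ℝ Ω1] [Module R Ω1] [IsScalarTower ℝ R Ω1]
    [AddCommGroup Ω2] [Module ℝ Ω2] [Module R Ω2] [IsScalarTower ℝ R Ω2]
    [AddCommGroup Ω3] [Module ℝ Ω3] [Module R Ω3] [IsScalarTower ℝ R Ω3]
    (C : CartanCalculus R V Ω1 Ω2 Ω3)


/-- The graph of `φ_B(X,f) = (i_X ω + f α, −i_X α)` is already a submodule, so it is
its own span. -/
theorem CartanCalculus.mem_span_formGraph_iff (ω : Ω2) (α : Ω1)
    (e : (V × R) × (Ω1 × R)) :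
    e ∈ Submodule.span R
        {e : (V × R) × (Ω1 × R) |
          e.2.1 = C.ι2 e.1.1 ω + e.1.2 • α ∧ e.2.2 = -(C.ι1 e.1.1 α)}
      ↔ e.2.1 = C.ι2 e.1.1 ω + e.1.2 • α ∧ e.2.2 = -(C.ι1 e.1.1 α) := by
  refine ⟨fun he => ?_, fun he => Submodule.subset_span he⟩
  induction he using Submodule.span_induction with
  | mem x hx => exact hx
  | zero => simp
  | add x y _ _ hx hy =>
    refine ⟨?_, ?_⟩
    · simp only [Prod.fst_add, Prod.snd_add, hx.1, hy.1, map_add, LinearMap.add_apply, add_smul]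
      abel
    · simp only [Prod.fst_add, Prod.snd_add, hx.2, hy.2, map_add, LinearMap.add_apply]
      abel
  | smul a x _ hx =>
    refine ⟨?_, ?_⟩
    · simp only [Prod.smul_fst, Prod.smul_snd, hx.1, C.ι2_smul_left, smul_add, smul_eq_mul,
        mul_smul]
    · simp only [Prod.smul_fst, Prod.smul_snd, hx.2, C.ι1_smul_left, smul_eq_mul, mul_neg]

/-- `i_Z (L_X β) = X ⬝ (i_Z β) − i_{[X,Z]} β`. -/
theorem CartanCalculus.ι1_lieD_s10 (X Z : V) (β : Ω1) :
    C.ι1 Z (C.lieD X β) = C.ι1 X (C.d0 (C.ι1 Z β)) - C.ι1 (C.lie X Z) β := by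
  simp only [CartanCalculus.lieD, map_add, C.eval_d1]
  ring

theorem CartanCalculus.ι1_form_ext {β γ : Ω1} (h : ∀ X, C.ι1 X β = C.ι1 X γ) : β = γ :=
  sub_eq_zero.1 <| C.ι1_nondeg_form _ fun X => by rw [map_sub, h, sub_self]

theorem CartanCalculus.two_form_ext {ω θ : Ω2}
    (h : ∀ X Y, C.ι1 Y (C.ι2 X ω) = C.ι1 Y (C.ι2 X θ)) : ω = θ :=
  sub_eq_zero.1 <| C.ι2_nondeg _ fun X => by
    rw [map_sub, C.ι1_form_ext (h X), sub_self]

/-- On the graph of `φ_B`, the function component of the extended Courant bracket is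
`−X ⬝ (i_Y α) + Y ⬝ (i_X α) + ω(X,Y)`. -/
theorem CartanCalculus.ebracket_formGraph_snd_snd (ω : Ω2) (α : Ω1) (X Y : V) (f g : R) :
    (C.ebracket ((X, f), (C.ι2 X ω + f • α, -(C.ι1 X α)))
        ((Y, g), (C.ι2 Y ω + g • α, -(C.ι1 Y α)))).2.2
      = -C.ι1 X (C.d0 (C.ι1 Y α)) + C.ι1 Y (C.d0 (C.ι1 X α)) + C.ι1 Y (C.ι2 X ω) := by
  have h2 : algebraMap ℝ R 2⁻¹ * 2 = 1 := by
    rw [← map_ofNat (algebraMap ℝ R) 2, ← map_mul]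
    norm_num
  simp only [CartanCalculus.ebracket, CartanCalculus.Xdot, map_add, map_neg, C.ι1_smul_right,
    Algebra.smul_def, C.ι2_skew Y X ω]
  linear_combination (C.ι1 Y (C.ι2 X ω)) * h2

/-- On the graph of `φ_B` with `ω = dα`, the 1-form component of the extended Courant bracket
is `i_{[X,Y]} dα + (X ⬝ g − Y ⬝ f) α`. -/
theorem CartanCalculus.ebracket_formGraph_snd_fst (α : Ω1) (X Y : V) (f g : R) :
    (C.ebracket ((X, f), (C.ι2 X (C.d1 α) + f • α, -(C.ι1 X α)))
        ((Y, g), (C.ι2 Y (C.d1 α) + g • α, -(C.ι1 Y α)))).2.1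
      = C.ι2 (C.lie X Y) (C.d1 α) + (C.Xdot X g - C.Xdot Y f) • α := by
  have h2 : algebraMap ℝ R 2⁻¹ * 2 = 1 := by
    rw [← map_ofNat (algebraMap ℝ R) 2, ← map_mul]
    norm_num
  refine C.ι1_form_ext fun Z => ?_
  have hclosed := C.eval_d2 X Y Z (C.d1 α)
  rw [C.d2_d1, map_zero, map_zero, map_zero] at hclosed
  have hXZ := C.eval_d1 X Z α
  have hYZ := C.eval_d1 Y Z α
  simp only [CartanCalculus.ebracket, CartanCalculus.Xdot, map_add, map_sub, map_neg,
    C.ι1_lieD_s10, C.ι1_smul_right, map_smul, C.d0_mul, C.ι2_skew Y X (C.d1 α),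
    C.ι2_skew Y (C.lie X Z) (C.d1 α), C.ι2_skew X (C.lie Y Z) (C.d1 α)]
  simp only [Algebra.smul_def]
  linear_combination -hclosed - g * hXZ + f * hYZ
    + (C.ι1 Z (C.d0 (C.ι1 Y (C.ι2 X (C.d1 α)))) + f * C.ι1 Z (C.d0 (C.ι1 Y α))
      - g * C.ι1 Z (C.d0 (C.ι1 X α))) * h2

/-- The graph of the bundle map
`φ_B(X,f) = (i_X ω + f α₀, −i_X α₀)` is a Dirac structure of `E^1(M)` if and
only if `ω = dα₀`. -/
theorem exact_two_form_dirac (ω : Ω2) (α0 : Ω1) :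
    C.IsDiracE (Submodule.span R
        {e : (V × R) × (Ω1 × R) |
          e.2.1 = C.ι2 e.1.1 ω + e.1.2 • α0 ∧ e.2.2 = -(C.ι1 e.1.1 α0)})
      ↔ ω = C.d1 α0 := by
  simp only [CartanCalculus.IsDiracE, CartanCalculus.IsMaxIsotropicE,
    CartanCalculus.IsIsotropicE, C.mem_span_formGraph_iff]
  constructor
  · rintro ⟨-, hclosed⟩
    refine C.two_form_ext fun X Y => ?_
    have h := (hclosed ((X, 0), (C.ι2 X ω + (0 : R) • α0, -(C.ι1 X α0))) ⟨rfl, rfl⟩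
      ((Y, 0), (C.ι2 Y ω + (0 : R) • α0, -(C.ι1 Y α0))) ⟨rfl, rfl⟩).2
    rw [C.ebracket_formGraph_snd_snd] at h
    simp only [CartanCalculus.ebracket] at h
    rw [C.eval_d1]
    linear_combination h
  · rintro rfl
    refine ⟨⟨?_, ?_⟩, ?_⟩
    · rintro ⟨⟨X, f⟩, β, l⟩ ⟨hβ, hl⟩ ⟨⟨Y, g⟩, γ, m⟩ ⟨hγ, hm⟩
      dsimp only at hβ hl hγ hm
      subst hβ hl hγ hm
      simp only [CartanCalculus.pairPlusE, map_add, C.ι1_smul_right, C.ι2_skew Y X]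
      convert smul_zero (2⁻¹ : ℝ) using 2
      ring
    · rintro ⟨⟨X, f⟩, β, l⟩ h
      have h' (Y : V) (g : R) := (smul_eq_zero_iff_right (inv_ne_zero two_ne_zero)).1 <|
        h ((Y, g), (C.ι2 Y (C.d1 α0) + g • α0, -(C.ι1 Y α0))) ⟨rfl, rfl⟩
      simp only [map_add, C.ι1_smul_right] at h'
      refine ⟨C.ι1_form_ext fun Y => ?_, ?_⟩
      · simp only [map_add, C.ι1_smul_right]
        linear_combination h' Y 0 - C.ι2_skew Y X (C.d1 α0)
      · have h1 := h' 0 1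
        simp only [map_zero, LinearMap.zero_apply] at h1
        linear_combination h1
    · rintro ⟨⟨X, f⟩, β, l⟩ ⟨hβ, hl⟩ ⟨⟨Y, g⟩, γ, m⟩ ⟨hγ, hm⟩
      dsimp only at hβ hl hγ hm
      subst hβ hl hγ hm
      refine ⟨C.ebracket_formGraph_snd_fst α0 X Y f g, ?_⟩
      rw [C.ebracket_formGraph_snd_snd, C.eval_d1]
      simp only [CartanCalculus.ebracket]
      ring

end ConformalDirac
end
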